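/- arXiv:1106.3859 — 13 statements merged into one kernel-verified Lean document; each statement's English description precedes it below -/
import Mathlib

section
/- Let a : ℝ → ℝ be positive and continuously differentiable on (0,∞), and fix χ > 0. Suppose that on an open interval I ⊆ (0,∞) there is a function t_ℓ : I → ℝ with 0 < t_ℓ(τ) < τ and ∫_{t_ℓ(τ)}^{τ} ds/a(s) = χ for all τ ∈ I. Define the affine distance δ(τ) = (1/a(τ)) ∫_{t_ℓ(τ)}^{τ} a(s) ds. Then δ is differentiable on I and δ'(τ) = 1 − (a'(τ)/a(τ)) δ(τ) − a(t_ℓ(τ))² / a(τ)². -/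
open Real Set MeasureTheory intervalIntegral

theorem ContinuousOn.intervalIntegrable_of_pos {f : ℝ → ℝ} (hf : ContinuousOn f (Ioi 0))
    {x y : ℝ} (hx : 0 < x) (hy : 0 < y) : IntervalIntegrable f volume x y :=
  (hf.mono fun _ hs => lt_of_lt_of_le (lt_min hx hy) hs.1).intervalIntegrable

theorem ContinuousOn.hasStrictDerivAt_integral_Ioi {f : ℝ → ℝ} (hf : ContinuousOn f (Ioi 0))
    {x : ℝ} (hx : 0 < x) : HasStrictDerivAt (fun u => ∫ s in (1 : ℝ)..u, f s) (f x) x :=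
  integral_hasStrictDerivAt_right (hf.intervalIntegrable_of_pos one_pos hx)
    (hf.stronglyMeasurableAtFilter isOpen_Ioi x hx) (hf.continuousAt (Ioi_mem_nhds hx))

theorem ContinuousOn.integral_eq_sub_of_pos {f : ℝ → ℝ} (hf : ContinuousOn f (Ioi 0))
    {x y : ℝ} (hx : 0 < x) (hy : 0 < y) :
    ∫ s in x..y, f s = (∫ s in (1 : ℝ)..y, f s) - ∫ s in (1 : ℝ)..x, f s :=
  (integral_interval_sub_left (hf.intervalIntegrable_of_pos one_pos hy)
    (hf.intervalIntegrable_of_pos one_pos hx)).symm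

theorem ContinuousOn.strictMonoOn_integral_of_pos {f : ℝ → ℝ} (hf : ContinuousOn f (Ioi 0))
    (hpos : ∀ t ∈ Ioi (0 : ℝ), 0 < f t) :
    StrictMonoOn (fun u => ∫ s in (1 : ℝ)..u, f s) (Ioi 0) := by
  intro x hx y hy hxy
  rw [← sub_pos, ← hf.integral_eq_sub_of_pos hx hy]
  exact intervalIntegral_pos_of_pos_on (hf.intervalIntegrable_of_pos hx hy)
    (fun s hs => hpos s (lt_trans hx hs.1)) hxy

/-- A function that lands in a set on which `F` is injective, and whose composition with `F` is
differentiable, is itself differentiable wherever `F` has a nonzero strict derivative. -/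
theorem HasDerivAt.of_comp_of_injOn {F G g : ℝ → ℝ} {F' G' x : ℝ} {s : Set ℝ}
    (hs : s ∈ nhds (g x)) (hinj : InjOn F s) (hF : HasStrictDerivAt F F' (g x)) (hF' : F' ≠ 0)
    (hG : HasDerivAt G G' x) (hg : ∀ᶠ y in nhds x, g y ∈ s)
    (hFg : ∀ᶠ y in nhds x, F (g y) = G y) : HasDerivAt g (F'⁻¹ * G') x := by
  have hx : F (g x) = G x := hFg.self_of_nhds
  have hφ := hF.to_localInverse hF'
  have hφx : hF.localInverse F F' (g x) hF' (F (g x)) = g x :=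
    HasStrictFDerivAt.localInverse_apply_image _
  have hright : ∀ᶠ y in nhds (F (g x)), F (hF.localInverse F F' (g x) hF' y) = y :=
    HasStrictFDerivAt.eventually_right_inverse _
  have hmem : ∀ᶠ y in nhds (F (g x)), hF.localInverse F F' (g x) hF' y ∈ s := by
    apply hφ.hasDerivAt.continuousAt
    rwa [hφx]
  rw [hx] at hφ hright hmem
  refine (hφ.hasDerivAt.comp x hG).congr_of_eventuallyEq ?_
  filter_upwards [hg, hFg, hG.continuousAt.eventually hright, hG.continuousAt.eventually hmem]
    with y h1 h2 h3 h4
  exact hinj h1 h4 (h2.trans h3.symm)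

/-- For a comoving test particle in a Robertson–Walker spacetime, the
affine (observed) distance `δ(τ) = (1/a(τ)) ∫_{t_ℓ(τ)}^{τ} a(s) ds` is differentiable and
`δ'(τ) = 1 − (a'(τ)/a(τ)) δ(τ) − a(t_ℓ(τ))² / a(τ)²`. -/
theorem astrometric_derivative
    (a a' : ℝ → ℝ) (χ : ℝ) (hχ : 0 < χ)
    (hapos : ∀ t ∈ Ioi (0:ℝ), 0 < a t)
    (hderiv : ∀ t ∈ Ioi (0:ℝ), HasDerivAt a (a' t) t)
    (hcont : ContinuousOn a' (Ioi 0))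
    (I : Set ℝ) (b c : ℝ) (hI : I = Ioo b c) (hIsub : I ⊆ Ioi 0)
    (tl : ℝ → ℝ)
    (htl : ∀ τ ∈ I, 0 < tl τ ∧ tl τ < τ)
    (hchi : ∀ τ ∈ I, (∫ s in tl τ..τ, 1 / a s) = χ)
    (δ : ℝ → ℝ)
    (hδ : ∀ τ, δ τ = (1 / a τ) * ∫ s in tl τ..τ, a s) :
    ∀ τ ∈ I, HasDerivAt δ (1 - (a' τ / a τ) * δ τ - (a (tl τ))^2 / (a τ)^2) τ := by
  intro τ hτ
  have ha : ContinuousOn a (Ioi 0) := fun t ht => (hderiv t ht).continuousAt.continuousWithinAt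
  have hinv : ContinuousOn (fun s => 1 / a s) (Ioi 0) :=
    continuousOn_const.div ha fun t ht => (hapos t ht).ne'
  have hmemI : ∀ᶠ y in nhds τ, y ∈ I := by
    subst hI
    exact isOpen_Ioo.mem_nhds hτ
  have hτ0 : 0 < τ := hIsub hτ
  have hl0 : 0 < tl τ := (htl τ hτ).1
  have haτ : a τ ≠ 0 := (hapos τ hτ0).ne'
  have hal : a (tl τ) ≠ 0 := (hapos _ hl0).ne'
  have htl' : HasDerivAt tl ((1 / a (tl τ))⁻¹ * (1 / a τ)) τ := by
    refine HasDerivAt.of_comp_of_injOn (Ioi_mem_nhds hl0)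
      (hinv.strictMonoOn_integral_of_pos fun t ht => one_div_pos.2 (hapos t ht)).injOn
      (hinv.hasStrictDerivAt_integral_Ioi hl0) (one_div_ne_zero hal)
      ((hinv.hasStrictDerivAt_integral_Ioi hτ0).hasDerivAt.sub_const χ)
      (hmemI.mono fun y hy => (htl y hy).1) (hmemI.mono fun y hy => ?_)
    have h := hinv.integral_eq_sub_of_pos (htl y hy).1 (hIsub hy)
    rw [hchi y hy] at h
    linarith
  have hint := (ha.hasStrictDerivAt_integral_Ioi hτ0).hasDerivAt.sub
    ((ha.hasStrictDerivAt_integral_Ioi hl0).hasDerivAt.comp τ htl')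
  have hquot := hint.div (hderiv τ hτ0) haτ
  refine (hquot.congr_of_eventuallyEq (hmemI.mono fun y hy => ?_)).congr_deriv ?_
  · rw [hδ, ha.integral_eq_sub_of_pos (htl y hy).1 (hIsub hy), one_div_mul_eq_div]
    rfl
  · rw [hδ, ha.integral_eq_sub_of_pos hl0 hτ0]
    simp only [Pi.sub_apply, Function.comp_apply]
    field_simp
    ring
end

section
/- Let a : ℝ → ℝ be positive, continuously differentiable and nondecreasing on (0,∞) (a'(t) ≥ 0), and fix χ > 0. Suppose that on an open interval I ⊆ (0,∞) there is a function t_ℓ : I → ℝ with 0 < t_ℓ(τ) < τ and ∫_{t_ℓ(τ)}^{τ} ds/a(s) = χ for all τ ∈ I, and define δ(τ) = (1/a(τ)) ∫_{t_ℓ(τ)}^{τ} a(s) ds. Then for every τ ∈ I, δ'(τ) < 1; that is, the astrometric relative speed of a radially receding comoving test particle in an expanding Robertson-Walker spacetime is always less than the local speed of light c = 1. -/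
open Real Set MeasureTheory intervalIntegral

/-- The fundamental theorem of calculus for a continuous integrand on the positive half-line. -/
theorem hasStrictDerivAt_integral_of_continuousOn_Ioi {f : ℝ → ℝ} (hf : ContinuousOn f (Ioi 0))
    {x t : ℝ} (hx : 0 < x) (ht : 0 < t) :
    HasStrictDerivAt (fun u => ∫ s in x..u, f s) (f t) t :=
  integral_hasStrictDerivAt_right
    (hf.mono fun _ hs => (lt_min hx ht).trans_le hs.1).intervalIntegrable
    (hf.stronglyMeasurableAtFilter isOpen_Ioi t ht)
    (hf.continuousAt (Ioi_mem_nhds ht))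

/-- A positive function `g` solving `F (g σ) = F σ - χ` near `τ`, where `F` is strictly
differentiable with nonzero derivative at `g τ` and injective on the positive half-line, is
differentiable at `τ`. -/
theorem hasDerivAt_of_injOn_comp_eq_sub {F g : ℝ → ℝ} {χ τ p q : ℝ}
    (hF : HasStrictDerivAt F p (g τ)) (hp : p ≠ 0) (hFτ : HasDerivAt F q τ) (hinj : InjOn F (Ioi 0))
    (hg : ∀ᶠ σ in nhds τ, 0 < g σ ∧ F (g σ) = F σ - χ) :
    HasDerivAt g (p⁻¹ * q) τ := by
  have hgτ := hg.self_of_nhds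
  set G := hF.localInverse F p (g τ) hp
  have hG' : HasStrictDerivAt G p⁻¹ (F (g τ)) := hF.to_localInverse hp
  have hGeq : G (F (g τ)) = g τ :=
    (hF.eventually_left_inverse hp).self_of_nhds
  have hright : ∀ᶠ y in nhds (F (g τ)), F (G y) = y :=
    hF.eventually_right_inverse hp
  have hpos : ∀ᶠ y in nhds (F (g τ)), 0 < G y :=
    hG'.hasDerivAt.continuousAt.eventually_const_lt (by rw [hGeq]; exact hgτ.1)
  have hsub : HasDerivAt (fun σ => F σ - χ) q τ := hFτ.sub_const χ
  have htend : Filter.Tendsto (fun σ => F σ - χ) (nhds τ) (nhds (F (g τ))) := by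
    rw [hgτ.2]
    exact hsub.continuousAt
  have hcomp : HasDerivAt (fun σ => G (F σ - χ)) (p⁻¹ * q) τ :=
    HasDerivAt.comp τ (by rw [← hgτ.2]; exact hG'.hasDerivAt) hsub
  refine hcomp.congr_of_eventuallyEq ?_
  filter_upwards [hg, htend.eventually hright, htend.eventually hpos] with σ h₁ h₂ h₃
  exact hinj h₁.1 h₃ (h₁.2.trans h₂.symm)

/-- In an expanding Robertson–Walker spacetime (`a' ≥ 0`), the astrometric
relative speed `δ'(τ)` of a radially receding comoving test particle is always less than
the local speed of light `c = 1`. -/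
theorem astrometric_speed_subluminal
    (a a' : ℝ → ℝ) (χ : ℝ) (hχ : 0 < χ)
    (hapos : ∀ t ∈ Ioi (0:ℝ), 0 < a t)
    (hderiv : ∀ t ∈ Ioi (0:ℝ), HasDerivAt a (a' t) t)
    (hcont : ContinuousOn a' (Ioi 0))
    (hmono : ∀ t ∈ Ioi (0:ℝ), 0 ≤ a' t)
    (I : Set ℝ) (b c : ℝ) (hI : I = Ioo b c) (hIsub : I ⊆ Ioi 0)
    (tl : ℝ → ℝ)
    (htl : ∀ τ ∈ I, 0 < tl τ ∧ tl τ < τ)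
    (hchi : ∀ τ ∈ I, (∫ s in tl τ..τ, 1 / a s) = χ)
    (δ : ℝ → ℝ)
    (hδ : ∀ τ, δ τ = (1 / a τ) * ∫ s in tl τ..τ, a s) :
    ∀ τ ∈ I, deriv δ τ < 1 := by
  intro τ hτ
  have hτ0 : 0 < τ := hIsub hτ
  have hInhds : I ∈ nhds τ := by
    rw [hI] at hτ ⊢
    exact Ioo_mem_nhds hτ.1 hτ.2
  have hacont : ContinuousOn a (Ioi 0) := fun t ht => (hderiv t ht).continuousAt.continuousWithinAt
  have hicont : ContinuousOn (fun s => 1 / a s) (Ioi 0) :=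
    continuousOn_const.div hacont fun t ht => (hapos t ht).ne'
  have hsplit : ∀ f : ℝ → ℝ, ContinuousOn f (Ioi 0) → ∀ x > 0, ∀ y > 0,
      ∫ s in x..y, f s = (∫ s in τ..y, f s) - ∫ s in τ..x, f s := by
    intro f hf x hx y hy
    have hint : ∀ z > 0, IntervalIntegrable f volume τ z := fun z hz =>
      (hf.mono fun _ hs => (lt_min hτ0 hz).trans_le hs.1).intervalIntegrable
    exact (integral_interval_sub_left (hint y hy) (hint x hx)).symm
  have hF : ∀ t > 0, HasStrictDerivAt (fun u => ∫ s in τ..u, 1 / a s) (1 / a t) t := fun t ht =>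
    hasStrictDerivAt_integral_of_continuousOn_Ioi hicont hτ0 ht
  have hH : ∀ t > 0, HasDerivAt (fun u => ∫ s in τ..u, a s) (a t) t := fun t ht =>
    (hasStrictDerivAt_integral_of_continuousOn_Ioi hacont hτ0 ht).hasDerivAt
  have hinj : InjOn (fun u => ∫ s in τ..u, 1 / a s) (Ioi 0) := by
    refine (strictMonoOn_of_deriv_pos (convex_Ioi 0)
      (fun t ht => (hF t ht).hasDerivAt.continuousAt.continuousWithinAt) fun t ht => ?_).injOn
    rw [interior_Ioi] at ht
    rw [(hF t ht).hasDerivAt.deriv]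
    exact one_div_pos.2 (hapos t ht)
  obtain ⟨hl0, hlτ⟩ := htl τ hτ
  have haτ := hapos τ hτ0
  have hal := hapos _ hl0
  have htl' : HasDerivAt tl ((1 / a (tl τ))⁻¹ * (1 / a τ)) τ := by
    refine hasDerivAt_of_injOn_comp_eq_sub (χ := χ) (hF _ hl0) (one_div_pos.2 hal).ne'
      (hF τ hτ0).hasDerivAt hinj ?_
    filter_upwards [hInhds] with σ hσ
    have h := hsplit _ hicont _ (htl σ hσ).1 σ (hIsub hσ)
    rw [hchi σ hσ] at h
    exact ⟨(htl σ hσ).1, by linarith⟩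
  have hN : HasDerivAt (fun σ => ∫ s in tl σ..σ, a s)
      (a τ - a (tl τ) * ((1 / a (tl τ))⁻¹ * (1 / a τ))) τ := by
    refine ((hH τ hτ0).sub ((hH _ hl0).comp τ htl')).congr_of_eventuallyEq ?_
    filter_upwards [hInhds] with σ hσ
    exact hsplit a hacont _ (htl σ hσ).1 σ (hIsub hσ)
  have hJ : 0 ≤ ∫ s in tl τ..τ, a s :=
    integral_nonneg hlτ.le fun s hs => (hapos s (hl0.trans_le hs.1)).le
  have hδ' := (hN.div (hderiv τ hτ0) haτ.ne').congr_of_eventuallyEq (f₁ := δ)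
    (.of_forall fun σ => by rw [hδ σ, one_div_mul_eq_div, Pi.div_apply])
  rw [hδ'.deriv, div_lt_one (pow_pos haτ 2)]
  have h₁ : (a τ - a (tl τ) * ((1 / a (tl τ))⁻¹ * (1 / a τ))) * a τ
      = a τ ^ 2 - a (tl τ) ^ 2 := by
    field_simp
  rw [h₁]
  nlinarith [mul_nonneg hJ (hmono τ hτ0), pow_pos hal 2]
end

section
/- Let 0 < α < 1 and τ > 0. Then the improper integral ∫_0^τ (τ/t)^α (τ^{2α} − t^{2α})^{−1/2} dt converges and equals (τ^{1−α}/(1−α)) · C_α, where C_α = √π · Γ((1+α)/(2α)) / Γ(1/(2α)) and Γ is the Gamma function. Consequently, the proper radius of the Fermi space slice of a comoving observer at proper time τ in the Robertson-Walker spacetime with scale factor a(t) = t^α is ∫_0^τ t^α (τ^{2α} − t^{2α})^{−1/2} dt = C_α τ. -/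
open Real Set MeasureTheory

/-- The beta integrand is integrable on `(0, 1)` and integrates to the beta function. -/
theorem integrableOn_and_integral_beta {u v : ℝ} (hu : 0 < u) (hv : 0 < v) :
    IntegrableOn (fun x : ℝ => x ^ (u - 1) * (1 - x) ^ (v - 1)) (Ioo 0 1) ∧
    ∫ x in Ioo (0 : ℝ) 1, x ^ (u - 1) * (1 - x) ^ (v - 1) = ProbabilityTheory.beta u v := by
  have hcongr : EqOn (fun x : ℝ => (x : ℂ) ^ ((u : ℂ) - 1) * (1 - (x : ℂ)) ^ ((v : ℂ) - 1))
      (fun x : ℝ => ((x ^ (u - 1) * (1 - x) ^ (v - 1) : ℝ) : ℂ)) (Ioo 0 1) := by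
    intro x hx
    have h1 : 0 ≤ 1 - x := by linarith [hx.2]
    simp only [Complex.ofReal_mul, Complex.ofReal_cpow hx.1.le, Complex.ofReal_cpow h1,
      Complex.ofReal_sub, Complex.ofReal_one]
  have hconv := Complex.betaIntegral_convergent (u := u) (v := v) (by simpa) (by simpa)
  rw [intervalIntegrable_iff_integrableOn_Ioo_of_le zero_le_one] at hconv
  have hint := (integrableOn_congr_fun hcongr measurableSet_Ioo).1 hconv
  refine ⟨by simpa using! hint.re, ?_⟩
  rw [ProbabilityTheory.beta_eq_betaIntegralReal u v hu hv, Complex.betaIntegral,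
    intervalIntegral.integral_of_le zero_le_one, integral_Ioc_eq_integral_Ioo,
    setIntegral_congr_fun measurableSet_Ioo hcongr, integral_complex_ofReal, Complex.ofReal_re]

theorem image_div_rpow_Ioo {p τ : ℝ} (hp : 0 < p) (hτ : 0 < τ) :
    (fun t : ℝ => (t / τ) ^ p) '' Ioo 0 τ = Ioo 0 1 := by
  ext y
  constructor
  · rintro ⟨t, ht, rfl⟩
    have h0 : 0 < t / τ := div_pos ht.1 hτ
    exact ⟨rpow_pos_of_pos h0 _, rpow_lt_one h0.le ((div_lt_one hτ).2 ht.2) hp⟩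
  · rintro ⟨h0, h1⟩
    have hlt : y ^ p⁻¹ < 1 := rpow_lt_one h0.le h1 (inv_pos.2 hp)
    refine ⟨τ * y ^ p⁻¹, ⟨mul_pos hτ (rpow_pos_of_pos h0 _), by nlinarith⟩, ?_⟩
    simp only [mul_div_cancel_left₀ _ hτ.ne', rpow_inv_rpow h0.le hp.ne']

/-- The substitution `x = (t / τ) ^ p` in the beta integral with second parameter `1 / 2`. -/
theorem integrableOn_and_integral_rpow_div_sqrt_one_sub {p τ u : ℝ} (hp : 0 < p) (hτ : 0 < τ)
    (hu : 0 < u) :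
    IntegrableOn (fun t => (t / τ) ^ (p * u - 1) / √(1 - (t / τ) ^ p)) (Ioo 0 τ) ∧
    ∫ t in Ioo 0 τ, (t / τ) ^ (p * u - 1) / √(1 - (t / τ) ^ p) =
      τ / p * ProbabilityTheory.beta u (1 / 2) := by
  have hderiv : ∀ t ∈ Ioo 0 τ, HasDerivWithinAt (fun t : ℝ => (t / τ) ^ p)
      (1 / τ * p * (t / τ) ^ (p - 1)) (Ioo 0 τ) t := fun t ht =>
    (((hasDerivAt_id t).div_const τ).rpow_const
      (Or.inl (div_pos ht.1 hτ).ne')).hasDerivWithinAt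
  have hinj : InjOn (fun t : ℝ => (t / τ) ^ p) (Ioo 0 τ) := by
    intro s hs t ht hst
    have := rpow_left_injOn hp.ne' (div_pos hs.1 hτ).le (div_pos ht.1 hτ).le hst
    field_simp at this
    exact this
  have hcongr : EqOn (fun t => |1 / τ * p * (t / τ) ^ (p - 1)| •
        (((t / τ) ^ p) ^ (u - 1) * (1 - (t / τ) ^ p) ^ ((1 / 2 : ℝ) - 1)))
      (fun t => p / τ * ((t / τ) ^ (p * u - 1) / √(1 - (t / τ) ^ p))) (Ioo 0 τ) := by
    intro t ht
    have h0 : 0 < t / τ := div_pos ht.1 hτ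
    have h1 : 0 ≤ 1 - (t / τ) ^ p :=
      sub_nonneg.2 (rpow_lt_one h0.le ((div_lt_one hτ).2 ht.2) hp).le
    have hexp : (t / τ) ^ (p * u - 1) = (t / τ) ^ (p - 1) * ((t / τ) ^ p) ^ (u - 1) := by
      rw [← rpow_mul h0.le, ← rpow_add h0]
      ring_nf
    have hsqrt : (1 - (t / τ) ^ p) ^ ((1 / 2 : ℝ) - 1) = (√(1 - (t / τ) ^ p))⁻¹ := by
      rw [sqrt_eq_rpow, ← rpow_neg h1]
      norm_num
    simp only [smul_eq_mul]
    rw [abs_of_pos (by positivity), hexp, hsqrt]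
    ring
  obtain ⟨hint, hval⟩ := integrableOn_and_integral_beta hu (one_half_pos (α := ℝ))
  rw [← image_div_rpow_Ioo hp hτ] at hint hval
  rw [integrableOn_image_iff_integrableOn_abs_deriv_smul measurableSet_Ioo hderiv hinj,
    integrableOn_congr_fun hcongr measurableSet_Ioo] at hint
  rw [integral_image_eq_integral_abs_deriv_smul measurableSet_Ioo hderiv hinj,
    setIntegral_congr_fun measurableSet_Ioo hcongr, integral_const_mul] at hval
  have hne : p / τ ≠ 0 := (div_pos hp hτ).ne'
  refine ⟨(integrable_const_mul_iff hne.isUnit _).1 hint, ?_⟩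
  rw [← hval]
  field_simp

theorem sqrt_rpow_two_mul_sub {α τ t : ℝ} (hτ : 0 < τ) (ht : 0 ≤ t) :
    √(τ ^ (2 * α) - t ^ (2 * α)) = τ ^ α * √(1 - (t / τ) ^ (2 * α)) := by
  have h : τ ^ (2 * α) = (τ ^ α) ^ 2 := by
    rw [← rpow_natCast, ← rpow_mul hτ.le]
    push_cast
    ring_nf
  have hpos := rpow_pos_of_pos hτ α
  have hfac : τ ^ (2 * α) - t ^ (2 * α) = (τ ^ α) ^ 2 * (1 - (t / τ) ^ (2 * α)) := by
    rw [div_rpow ht hτ.le, h]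
    field_simp
  rw [hfac, sqrt_mul (sq_nonneg _), sqrt_sq hpos.le]

/-- For `0 < α < 1` and `τ > 0`,
`∫_0^τ (τ/t)^α (τ^{2α} − t^{2α})^{−1/2} dt = (τ^{1−α}/(1−α)) C_α` with
`C_α = √π Γ((1+α)/(2α)) / Γ(1/(2α))`, and consequently the proper radius of the Fermi
space slice for `a(t) = t^α` is `∫_0^τ t^α (τ^{2α} − t^{2α})^{−1/2} dt = C_α τ`. -/
theorem fermi_slice_radius_power_law
    (α τ : ℝ) (hα : 0 < α) (hα1 : α < 1) (hτ : 0 < τ) :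
    IntegrableOn (fun t => (τ / t) ^ α / Real.sqrt (τ ^ (2*α) - t ^ (2*α))) (Ioo 0 τ) ∧
    (∫ t in Ioo 0 τ, (τ / t) ^ α / Real.sqrt (τ ^ (2*α) - t ^ (2*α))) =
      (τ ^ (1-α) / (1-α)) *
        (Real.sqrt π * Real.Gamma ((1+α)/(2*α)) / Real.Gamma (1/(2*α))) ∧
    IntegrableOn (fun t => t ^ α / Real.sqrt (τ ^ (2*α) - t ^ (2*α))) (Ioo 0 τ) ∧
    (∫ t in Ioo 0 τ, t ^ α / Real.sqrt (τ ^ (2*α) - t ^ (2*α))) =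
      (Real.sqrt π * Real.Gamma ((1+α)/(2*α)) / Real.Gamma (1/(2*α))) * τ := by
  have h2α : 0 < 2 * α := by linarith
  have h1α : 0 < 1 - α := by linarith
  have hτα := rpow_pos_of_pos hτ α
  have hu₁ : 0 < (1 - α) / (2 * α) := by positivity
  have hu₂ : 0 < (1 + α) / (2 * α) := by positivity
  have hc₁ : EqOn (fun t => (τ / t) ^ α / √(τ ^ (2 * α) - t ^ (2 * α)))
      (fun t => (τ ^ α)⁻¹ * ((t / τ) ^ (2 * α * ((1 - α) / (2 * α)) - 1) /
        √(1 - (t / τ) ^ (2 * α)))) (Ioo 0 τ) := by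
    intro t ht
    have hexp : (t / τ) ^ (2 * α * ((1 - α) / (2 * α)) - 1) = (τ / t) ^ α := by
      rw [mul_div_cancel₀ _ h2α.ne', ← inv_div τ t, inv_rpow (div_pos hτ ht.1).le,
        ← rpow_neg (div_pos hτ ht.1).le]
      ring_nf
    simp only [sqrt_rpow_two_mul_sub hτ ht.1.le, hexp]
    ring
  have hc₂ : EqOn (fun t => t ^ α / √(τ ^ (2 * α) - t ^ (2 * α)))
      (fun t => (t / τ) ^ (2 * α * ((1 + α) / (2 * α)) - 1) /
        √(1 - (t / τ) ^ (2 * α))) (Ioo 0 τ) := by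
    intro t ht
    have hexp : (t / τ) ^ (2 * α * ((1 + α) / (2 * α)) - 1) = t ^ α / τ ^ α := by
      rw [mul_div_cancel₀ _ h2α.ne', add_sub_cancel_left, div_rpow ht.1.le hτ.le]
    simp only [sqrt_rpow_two_mul_sub hτ ht.1.le, hexp]
    ring
  obtain ⟨hi₁, hv₁⟩ := integrableOn_and_integral_rpow_div_sqrt_one_sub h2α hτ hu₁
  obtain ⟨hi₂, hv₂⟩ := integrableOn_and_integral_rpow_div_sqrt_one_sub h2α hτ hu₂
  have hΓ : Gamma (1 / (2 * α)) ≠ 0 := (Gamma_pos_of_pos (by positivity)).ne'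
  refine ⟨(integrableOn_congr_fun hc₁ measurableSet_Ioo).2 (hi₁.const_mul _), ?_,
    (integrableOn_congr_fun hc₂ measurableSet_Ioo).2 hi₂, ?_⟩
  · have hsum : (1 - α) / (2 * α) + 1 / 2 = 1 / (2 * α) := by
      field_simp
      ring
    have hsucc : Gamma ((1 + α) / (2 * α)) =
        (1 - α) / (2 * α) * Gamma ((1 - α) / (2 * α)) := by
      rw [← Gamma_add_one hu₁.ne']
      congr 1
      field_simp
      ring
    rw [setIntegral_congr_fun measurableSet_Ioo hc₁, integral_const_mul, hv₁,
      ProbabilityTheory.beta, Gamma_one_half_eq, hsum, hsucc, rpow_sub hτ, rpow_one]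
    field_simp
  · have hsum : (1 + α) / (2 * α) + 1 / 2 = 1 / (2 * α) + 1 := by
      field_simp
      ring
    rw [setIntegral_congr_fun measurableSet_Ioo hc₂, hv₂, ProbabilityTheory.beta,
      Gamma_one_half_eq, hsum, Gamma_add_one (by positivity)]
    field_simp
end

section
/- Let 0 < α < 1 and let G be a function from an open interval of positive reals into (0,1) satisfying α ∫_{G(v)}^1 s^{−α}(1−s^{2α})^{−1/2} ds = v for all v in the interval. Fix χ > 0 and define, for τ > 0 with v(τ) := αχ τ^{α−1} in the domain of G, the Fermi distance ρ(τ) = τ ∫_{G(v(τ))}^1 s^α (1 − s^{2α})^{−1/2} ds. Then ρ is differentiable and the Fermi relative speed satisfies ρ'(τ) = G(v)^{1−α} √(1 − G(v)^{2α}) + ((1−α)/α)(1 − G(v)^{2α}) v, where v = v(τ). -/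
open Real Set MeasureTheory

open Filter Topology in
/-- A right inverse of a strictly antitone function on an
open interval is continuous. -/
theorem continuousAt_of_strictAntiOn_rightInverse {F G : ℝ → ℝ} {l r b c v : ℝ}
    (hF : StrictAntiOn F (Ioo l r)) (hG : ∀ u ∈ Ioo b c, G u ∈ Ioo l r)
    (hFG : ∀ u ∈ Ioo b c, F (G u) = u) (hv : v ∈ Ioo b c) : ContinuousAt G v := by
  have hmem : ∀ᶠ u in 𝓝 v, u ∈ Ioo b c := Ioo_mem_nhds hv.1 hv.2
  refine tendsto_order.2 ⟨fun a ha => ?_, fun a ha => ?_⟩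
  · by_cases hal : a ≤ l
    · filter_upwards [hmem] with u hu using hal.trans_lt (hG u hu).1
    · have ha' : a ∈ Ioo l r := ⟨not_le.1 hal, ha.trans (hG v hv).2⟩
      have h := hF ha' (hG v hv) ha
      rw [hFG v hv] at h
      filter_upwards [hmem, Iio_mem_nhds h] with u hu hua
      refine (hF.lt_iff_gt (hG u hu) ha').1 ?_
      rw [hFG u hu]
      exact hua
  · by_cases har : r ≤ a
    · filter_upwards [hmem] with u hu using (hG u hu).2.trans_le har
    · have ha' : a ∈ Ioo l r := ⟨(hG v hv).1.trans ha, not_le.1 har⟩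
      have h := hF (hG v hv) ha' ha
      rw [hFG v hv] at h
      filter_upwards [hmem, Ioi_mem_nhds h] with u hu hua
      refine (hF.lt_iff_gt ha' (hG u hu)).1 ?_
      rw [hFG u hu]
      exact hua

theorem one_sub_rpow_two_mul_pos {α x : ℝ} (hα : 0 < α) (hx : x ∈ Ioo (0 : ℝ) 1) :
    0 < 1 - x ^ (2 * α) :=
  sub_pos.2 (rpow_lt_one hx.1.le hx.2 (by positivity))

theorem hasDerivAt_sqrt_one_sub_rpow {α x : ℝ} (hα : 0 < α) (hx : x ∈ Ioo (0 : ℝ) 1) :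
    HasDerivAt (fun s : ℝ => √(1 - s ^ (2 * α)))
      (-(α * (x ^ (2 * α - 1) / √(1 - x ^ (2 * α))))) x := by
  have hpos := one_sub_rpow_two_mul_pos hα hx
  have h := ((hasDerivAt_rpow_const (p := 2 * α) (Or.inl hx.1.ne')).const_sub 1).sqrt hpos.ne'
  convert h using 1
  have := (sqrt_pos.2 hpos).ne'
  field_simp

theorem continuousOn_sqrt_one_sub_rpow {α : ℝ} (hα : 0 < α) (S : Set ℝ) :
    ContinuousOn (fun s : ℝ => √(1 - s ^ (2 * α))) S :=
  (continuous_const.sub (continuous_rpow_const (by positivity))).sqrt.continuousOn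

theorem intervalIntegrable_rpow_div_sqrt {α x : ℝ} (p : ℝ) (hα : 0 < α) (hx : x ∈ Ioo (0 : ℝ) 1) :
    IntervalIntegrable (fun s : ℝ => s ^ p / √(1 - s ^ (2 * α))) volume x 1 := by
  have h : IntervalIntegrable (fun s : ℝ => α * (s ^ (2 * α - 1) / √(1 - s ^ (2 * α))))
      volume x 1 := by
    refine (intervalIntegrable_iff_integrableOn_Ioc_of_le hx.2.le).2 <|
      intervalIntegral.integrableOn_deriv_of_nonneg
        (g := fun s : ℝ => -√(1 - s ^ (2 * α)))
        (continuousOn_sqrt_one_sub_rpow hα _).neg (fun s hs => ?_) (fun s hs => ?_)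
    · exact (hasDerivAt_sqrt_one_sub_rpow hα ⟨hx.1.trans hs.1, hs.2⟩).neg.congr_deriv (neg_neg _)
    · have : 0 < s := hx.1.trans hs.1
      positivity
  have hc : ContinuousOn (fun s : ℝ => α⁻¹ * s ^ (p - (2 * α - 1))) (uIcc x 1) := by
    rw [uIcc_of_le hx.2.le]
    exact continuousOn_const.mul
      (continuousOn_id.rpow_const fun s hs => Or.inl (hx.1.trans_le hs.1).ne')
  refine (h.continuousOn_mul hc).congr fun s hs => ?_
  rw [uIoc_of_le hx.2.le] at hs
  have hs0 : 0 < s := hx.1.trans hs.1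
  have hp : s ^ p = s ^ (p - (2 * α - 1)) * s ^ (2 * α - 1) := by
    rw [← rpow_add hs0]; ring_nf
  simp only [hp]
  field_simp

theorem hasDerivAt_integral_rpow_div_sqrt {α x : ℝ} (p : ℝ) (hα : 0 < α)
    (hx : x ∈ Ioo (0 : ℝ) 1) :
    HasDerivAt (fun y => ∫ s in Ioo y 1, s ^ p / √(1 - s ^ (2 * α)))
      (-(x ^ p / √(1 - x ^ (2 * α)))) x := by
  have hcont : ContinuousOn (fun s : ℝ => s ^ p / √(1 - s ^ (2 * α))) (Ioo 0 1) :=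
    (continuousOn_id.rpow_const fun s hs => Or.inl hs.1.ne').div
      (continuousOn_sqrt_one_sub_rpow hα _)
      fun s hs => (sqrt_pos.2 (one_sub_rpow_two_mul_pos hα hs)).ne'
  have h := intervalIntegral.integral_hasDerivAt_left (intervalIntegrable_rpow_div_sqrt p hα hx)
    (hcont.stronglyMeasurableAtFilter isOpen_Ioo x hx)
    (hcont.continuousAt (isOpen_Ioo.mem_nhds hx))
  refine h.congr_of_eventuallyEq ?_
  filter_upwards [Iio_mem_nhds hx.2] with y hy
  rw [intervalIntegral.integral_of_le (le_of_lt hy), integral_Ioc_eq_integral_Ioo]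

theorem strictAntiOn_integral_rpow_div_sqrt {α : ℝ} (p : ℝ) (hα : 0 < α) :
    StrictAntiOn (fun y => ∫ s in Ioo y 1, s ^ p / √(1 - s ^ (2 * α))) (Ioo 0 1) := by
  refine strictAntiOn_of_deriv_neg (convex_Ioo 0 1)
    (fun x hx => (hasDerivAt_integral_rpow_div_sqrt p hα hx).continuousAt.continuousWithinAt)
    fun x hx => ?_
  rw [interior_Ioo] at hx
  rw [(hasDerivAt_integral_rpow_div_sqrt p hα hx).deriv]
  exact neg_neg_of_pos
    (div_pos (rpow_pos_of_pos hx.1 p) (sqrt_pos.2 (one_sub_rpow_two_mul_pos hα hx)))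

theorem hasDerivAt_rpow_mul_sqrt_one_sub_rpow {α x : ℝ} (hα : 0 < α) (hx : x ∈ Ioo (0 : ℝ) 1) :
    HasDerivAt (fun s : ℝ => s ^ (1 - α) * √(1 - s ^ (2 * α)))
      ((1 - α) * (x ^ (-α) / √(1 - x ^ (2 * α))) - x ^ α / √(1 - x ^ (2 * α))) x := by
  have hpos := one_sub_rpow_two_mul_pos hα hx
  have h := (hasDerivAt_rpow_const (p := 1 - α) (Or.inl hx.1.ne')).mul
    (hasDerivAt_sqrt_one_sub_rpow hα hx)
  refine h.congr_deriv ?_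
  have hr := (sqrt_pos.2 hpos).ne'
  have hsq := sq_sqrt hpos.le
  have e1 : x ^ (1 - α - 1) = x ^ (-α) := by ring_nf
  have e2 : x ^ (1 - α) * x ^ (2 * α - 1) = x ^ α := by
    rw [← rpow_add hx.1]; ring_nf
  have e3 : x ^ (-α) * x ^ (2 * α) = x ^ α := by
    rw [← rpow_add hx.1]; ring_nf
  rw [e1]
  generalize √(1 - x ^ (2 * α)) = r at hr hsq
  generalize x ^ (2 * α - 1) = y at e2
  field_simp
  rw [hsq]
  linear_combination (-α) * e2 - (1 - α) * e3

/-- Integration by parts relating the two integrals in the Fermi distance. -/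
theorem integral_rpow_div_sqrt_eq {α x : ℝ} (hα : 0 < α) (hα1 : α < 1) (hx : x ∈ Ioo (0 : ℝ) 1) :
    ∫ s in Ioo x 1, s ^ α / √(1 - s ^ (2 * α)) =
      x ^ (1 - α) * √(1 - x ^ (2 * α)) +
        (1 - α) * ∫ s in Ioo x 1, s ^ (-α) / √(1 - s ^ (2 * α)) := by
  have h1 := (intervalIntegrable_rpow_div_sqrt (-α) hα hx).const_mul (1 - α)
  have h2 := intervalIntegrable_rpow_div_sqrt α hα hx
  have h := intervalIntegral.integral_eq_sub_of_hasDerivAt_of_le hx.2.le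
    (((continuous_rpow_const (sub_nonneg.2 hα1.le)).continuousOn).mul
      (continuousOn_sqrt_one_sub_rpow hα _))
    (fun s hs => hasDerivAt_rpow_mul_sqrt_one_sub_rpow hα ⟨hx.1.trans hs.1, hs.2⟩) (h1.sub h2)
  rw [intervalIntegral.integral_sub h1 h2, intervalIntegral.integral_const_mul] at h
  simp only [intervalIntegral.integral_of_le hx.2.le, integral_Ioc_eq_integral_Ioo, Pi.mul_apply,
    one_rpow, sub_self, sqrt_zero, mul_zero] at h
  linarith

/-- For `a(t) = t^α` with `0 < α < 1`, the Fermi distance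
`ρ(τ) = τ ∫_{G(v(τ))}^1 s^α (1 − s^{2α})^{−1/2} ds`, with `v(τ) = αχτ^{α−1}` and `G`
defined implicitly by `α ∫_{G(v)}^1 s^{−α}(1−s^{2α})^{−1/2} ds = v`, is differentiable and
the Fermi relative speed is
`ρ'(τ) = G(v)^{1−α} √(1 − G(v)^{2α}) + ((1−α)/α)(1 − G(v)^{2α}) v`. -/
theorem fermi_relative_speed_power_law
    (α : ℝ) (hα : 0 < α) (hα1 : α < 1)
    (b c : ℝ) (hb : 0 ≤ b) (G : ℝ → ℝ)
    (hG : ∀ v ∈ Ioo b c, G v ∈ Ioo (0:ℝ) 1)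
    (hGdef : ∀ v ∈ Ioo b c,
      α * (∫ s in Ioo (G v) 1, s ^ (-α) / Real.sqrt (1 - s ^ (2*α))) = v)
    (χ : ℝ) (hχ : 0 < χ)
    (v ρ : ℝ → ℝ)
    (hv : ∀ τ, v τ = α * χ * τ ^ (α - 1))
    (hρ : ∀ τ, ρ τ = τ * ∫ s in Ioo (G (v τ)) 1, s ^ α / Real.sqrt (1 - s ^ (2*α))) :
    ∀ τ, 0 < τ → v τ ∈ Ioo b c →
      HasDerivAt ρ ((G (v τ)) ^ (1-α) * Real.sqrt (1 - (G (v τ)) ^ (2*α))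
        + ((1-α)/α) * (1 - (G (v τ)) ^ (2*α)) * v τ) τ := by
  intro τ hτ hvτ
  have hx := hG _ hvτ
  have hpos := one_sub_rpow_two_mul_pos hα hx
  have hr := (sqrt_pos.2 hpos).ne'
  have hxα := (rpow_pos_of_pos hx.1 α).ne'
  have hcont : ContinuousAt G (v τ) := by
    refine continuousAt_of_strictAntiOn_rightInverse
      (F := fun y => α * ∫ s in Ioo y 1, s ^ (-α) / √(1 - s ^ (2 * α)))
      (fun y hy z hz hyz => ?_) hG hGdef hvτ
    exact mul_lt_mul_of_pos_left (strictAntiOn_integral_rpow_div_sqrt (-α) hα hy hz hyz) hα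
  have hGderiv := HasDerivAt.of_local_left_inverse hcont
    ((hasDerivAt_integral_rpow_div_sqrt (-α) hα hx).const_mul α)
    (mul_ne_zero hα.ne' (neg_ne_zero.2 (div_ne_zero (rpow_pos_of_pos hx.1 _).ne' hr)))
    (Filter.eventually_of_mem (Ioo_mem_nhds hvτ.1 hvτ.2) hGdef)
  have hvderiv : HasDerivAt v (α * χ * ((α - 1) * τ ^ (α - 1 - 1))) τ := by
    rw [funext hv]
    exact (hasDerivAt_rpow_const (Or.inl hτ.ne')).const_mul _
  have hρderiv := (hasDerivAt_id τ).mul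
    ((hasDerivAt_integral_rpow_div_sqrt α hα hx).comp τ (hGderiv.comp τ hvderiv))
  have hρ' : ρ = id * ((fun y => ∫ s in Ioo y 1, s ^ α / √(1 - s ^ (2 * α))) ∘ G ∘ v) :=
    funext hρ
  rw [hρ']
  refine hρderiv.congr_deriv ?_
  have hτv : τ * (α * χ * ((α - 1) * τ ^ (α - 1 - 1))) = (α - 1) * v τ := by
    rw [hv, rpow_sub_one hτ.ne' (α - 1)]
    field_simp
  have hF := hGdef _ hvτ
  have hxsq : G (v τ) ^ (2 * α) = G (v τ) ^ α * G (v τ) ^ α := by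
    rw [← rpow_add hx.1]; ring_nf
  have hslope : -(G (v τ) ^ α / √(1 - G (v τ) ^ (2 * α))) *
      (α * -(G (v τ) ^ (-α) / √(1 - G (v τ) ^ (2 * α))))⁻¹ = G (v τ) ^ (2 * α) / α := by
    rw [rpow_neg hx.1.le]
    generalize √(1 - G (v τ) ^ (2 * α)) = r at hr
    rw [hxsq]
    field_simp
  simp only [Function.comp_apply, id, one_mul]
  rw [integral_rpow_div_sqrt_eq hα hα1 hx, ← mul_assoc (-(_ / _)), hslope]
  have hI : ∫ s in Ioo (G (v τ)) 1, s ^ (-α) / √(1 - s ^ (2 * α)) = v τ / α := by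
    rw [eq_div_iff hα.ne', mul_comm]
    exact hF
  rw [hI]
  linear_combination (G (v τ) ^ (2 * α) / α) * hτv
end

section
/- Let 0 < α < 1, τ > 0 and 0 < χ < τ^{1−α}/(1−α), and set v = αχ/τ^{1−α} and t_ℓ = (τ^{1−α} − (1−α)χ)^{1/(1−α)}. Then: (i) ∫_{t_ℓ}^τ s^{−α} ds = χ and t_ℓ = (1 − ((1−α)/α)v)^{1/(1−α)} τ; (ii) the affine distance δ = τ^{−α} ∫_{t_ℓ}^τ s^α ds equals (τ/(1+α)) (1 − (1 − ((1−α)/α)v)^{(1+α)/(1−α)}); (iii) the spectroscopic relative speed (τ^{2α} − t_ℓ^{2α})/(τ^{2α} + t_ℓ^{2α}) equals (1 − (1 − ((1−α)/α)v)^{2α/(1−α)}) / (1 + (1 − ((1−α)/α)v)^{2α/(1−α)}). -/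
open Real Set MeasureTheory intervalIntegral

/-- Lightlike simultaneity for `a(t) = t^α` (`0 < α < 1`): with
`v = αχ/τ^{1−α}` and `t_ℓ = (τ^{1−α} − (1−α)χ)^{1/(1−α)}`:
(i) `∫_{t_ℓ}^τ s^{−α} ds = χ` and `t_ℓ = (1 − ((1−α)/α)v)^{1/(1−α)} τ`;
(ii) the affine distance `δ = τ^{−α} ∫_{t_ℓ}^τ s^α ds` equals
`(τ/(1+α))(1 − (1 − ((1−α)/α)v)^{(1+α)/(1−α)})`;
(iii) the spectroscopic speed `(τ^{2α} − t_ℓ^{2α})/(τ^{2α} + t_ℓ^{2α})` equals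
`(1 − (1 − ((1−α)/α)v)^{2α/(1−α)})/(1 + (1 − ((1−α)/α)v)^{2α/(1−α)})`. -/
theorem lightlike_power_law
    (α τ χ v tl : ℝ) (hα : 0 < α) (hα1 : α < 1) (hτ : 0 < τ)
    (hχ : 0 < χ) (hχ2 : χ < τ ^ (1-α) / (1-α))
    (hv : v = α * χ / τ ^ (1-α))
    (htl : tl = (τ ^ (1-α) - (1-α) * χ) ^ (1/(1-α))) :
    ((∫ s in tl..τ, s ^ (-α)) = χ ∧
      tl = (1 - ((1-α)/α) * v) ^ (1/(1-α)) * τ) ∧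
    τ ^ (-α) * (∫ s in tl..τ, s ^ α) =
      (τ/(1+α)) * (1 - (1 - ((1-α)/α) * v) ^ ((1+α)/(1-α))) ∧
    (τ ^ (2*α) - tl ^ (2*α)) / (τ ^ (2*α) + tl ^ (2*α)) =
      (1 - (1 - ((1-α)/α) * v) ^ (2*α/(1-α))) /
        (1 + (1 - ((1-α)/α) * v) ^ (2*α/(1-α))) := by
  have hb : 0 < 1 - α := sub_pos.mpr hα1
  have hP : 0 < τ ^ (1-α) := rpow_pos_of_pos hτ _
  have hw : 1 - ((1-α)/α) * v = (τ ^ (1-α) - (1-α) * χ) / τ ^ (1-α) := by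
    rw [hv]; field_simp
  have hD : 0 < τ ^ (1-α) - (1-α) * χ := by
    rw [lt_div_iff₀ hb] at hχ2; linarith
  have hw0 : 0 < 1 - ((1-α)/α) * v := hw ▸ div_pos hD hP
  have htl' : tl = (1 - ((1-α)/α) * v) ^ (1/(1-α)) * τ := by
    rw [htl, hw, div_rpow hD.le hP.le, ← rpow_mul hτ.le, mul_one_div_cancel hb.ne', rpow_one,
      div_mul_cancel₀ _ hτ.ne']
  have htl_rpow (p : ℝ) : tl ^ p = (1 - ((1-α)/α) * v) ^ (p/(1-α)) * τ ^ p := by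
    rw [htl', mul_rpow (rpow_nonneg hw0.le _) hτ.le, ← rpow_mul hw0.le, one_div_mul_eq_div]
  refine ⟨⟨?_, htl'⟩, ?_, ?_⟩
  · rw [integral_rpow (Or.inl (by linarith)), neg_add_eq_sub, htl_rpow, div_self hb.ne', rpow_one,
      hw, div_mul_cancel₀ _ hP.ne']
    field_simp
    ring
  · have hτ_pow : τ ^ (-α) * τ ^ (1+α) = τ := by
      rw [← rpow_add hτ, neg_add_cancel_comm_assoc, rpow_one]
    rw [integral_rpow (Or.inl (by linarith)), add_comm α 1, htl_rpow]
    linear_combination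
      (1 - (1 - ((1-α)/α) * v) ^ ((1+α)/(1-α))) / (1+α) * hτ_pow
  · have hτ_pos : 0 < τ ^ (2*α) := rpow_pos_of_pos hτ _
    rw [htl_rpow, ← one_sub_mul, ← one_add_mul, mul_div_mul_right _ _ hτ_pos.ne']
end

section
/- Let 0 < α < 1, fix χ > 0, and for τ > ((1−α)χ)^{1/(1−α)} define v(τ) = αχ τ^{α−1} and δ(τ) = (τ/(1+α)) (1 − (1 − ((1−α)/α) v(τ))^{(1+α)/(1−α)}). Then δ is differentiable and the astrometric relative speed satisfies δ'(τ) = δ(τ)/τ − ((1−α)/α) v(τ) (1 − ((1−α)/α) v(τ))^{2α/(1−α)}. -/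
open Real Set MeasureTheory

/-- For `a(t) = t^α` (`0 < α < 1`) and fixed `χ > 0`, the affine distance
`δ(τ) = (τ/(1+α))(1 − (1 − ((1−α)/α)v(τ))^{(1+α)/(1−α)})` with `v(τ) = αχτ^{α−1}` is
differentiable for `τ > ((1−α)χ)^{1/(1−α)}`, and the astrometric relative speed is
`δ'(τ) = δ(τ)/τ − ((1−α)/α) v(τ) (1 − ((1−α)/α)v(τ))^{2α/(1−α)}`. -/
theorem astrometric_speed_power_law
    (α χ : ℝ) (hα : 0 < α) (hα1 : α < 1) (hχ : 0 < χ)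
    (v δ : ℝ → ℝ)
    (hv : ∀ τ, v τ = α * χ * τ ^ (α-1))
    (hδ : ∀ τ, δ τ = (τ/(1+α)) * (1 - (1 - ((1-α)/α) * v τ) ^ ((1+α)/(1-α)))) :
    ∀ τ, ((1-α)*χ) ^ ((1:ℝ)/(1-α)) < τ →
      HasDerivAt δ
        (δ τ / τ - ((1-α)/α) * v τ * (1 - ((1-α)/α) * v τ) ^ (2*α/(1-α))) τ := by
  intro τ hτ
  have h1α : 0 < 1 - α := sub_pos.2 hα1
  have hτ0 : 0 < τ := (rpow_nonneg (mul_pos h1α hχ).le _).trans_lt hτ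
  have hp : 1 ≤ (1 + α) / (1 - α) := by
    rw [le_div_iff₀ h1α]
    linarith
  have hv' : HasDerivAt v ((α - 1) * v τ / τ) τ := by
    rw [funext hv]
    refine ((hasDerivAt_rpow_const (p := α - 1) (Or.inl hτ0.ne')).const_mul (α * χ)).congr_deriv ?_
    rw [rpow_sub_one hτ0.ne' (α - 1)]
    ring
  have hexp : (1 + α) / (1 - α) - 1 = 2 * α / (1 - α) := by
    field_simp
    ring
  have hpow := ((hv'.const_mul ((1 - α) / α)).const_sub 1).rpow_const
    (p := (1 + α) / (1 - α)) (Or.inr hp)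
  have hmul := ((hasDerivAt_id τ).div_const (1 + α)).mul (hpow.const_sub 1)
  rw [hexp] at hmul
  have hfun : δ = fun t => t / (1 + α) * (1 - (1 - (1 - α) / α * v t) ^ ((1 + α) / (1 - α))) :=
    funext hδ
  rw [hδ τ, hfun]
  refine hmul.congr_deriv ?_
  simp only [id]
  generalize (1 - (1 - α) / α * v τ) ^ ((1 + α) / (1 - α)) = A
  generalize (1 - (1 - α) / α * v τ) ^ (2 * α / (1 - α)) = B
  field_simp
  ring
end

section
/- Define f : [0, π/2) → ℝ by f(v) = sin v · (cos v + v sin v). Then: (i) f(v) < π/2 for all v ∈ [0, π/2); (ii) f(v) → π/2 as v → (π/2)⁻; (iii) there exists v ∈ (0, π/2) with f(v) > 1. Hence in the radiation-dominated universe the Fermi relative speed of a comoving test particle can exceed the local speed of light but is bounded above by π/2. -/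
open Real Set

/-- For `f(v) = sin v (cos v + v sin v)` on `[0, π/2)`:
(i) `f(v) < π/2`; (ii) `f(v) → π/2` as `v → (π/2)⁻`; (iii) some `v ∈ (0, π/2)` has
`f(v) > 1`. Hence in the radiation-dominated universe the Fermi relative speed of a
comoving particle can exceed the local speed of light but is bounded above by `π/2`. -/
theorem radiation_fermi_speed_bounds
    (f : ℝ → ℝ) (hf : ∀ v, f v = Real.sin v * (Real.cos v + v * Real.sin v)) :
    (∀ v ∈ Ico 0 (π/2), f v < π/2) ∧
    Filter.Tendsto f (nhdsWithin (π/2) (Iio (π/2))) (nhds (π/2)) ∧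
    (∃ v ∈ Ioo 0 (π/2), 1 < f v) := by
  have hone : 1 < π / 2 := by linarith [pi_gt_three]
  have hlim : Filter.Tendsto f (nhdsWithin (π/2) (Iio (π/2))) (nhds (π/2)) := by
    have hcont : Continuous f := by
      rw [funext hf]
      fun_prop
    have hval : f (π / 2) = π / 2 := by simp [hf]
    have h := hcont.tendsto (π / 2)
    rw [hval] at h
    exact h.mono_left nhdsWithin_le_nhds
  refine ⟨fun v ⟨h0, h1⟩ => ?_, hlim, ?_⟩
  · have hcos : 0 < cos v := cos_pos_of_mem_Ioo ⟨by linarith, h1⟩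
    have hcos_lt : cos v < π / 2 - v := by
      rw [← sin_pi_div_two_sub]
      exact sin_lt (by linarith)
    have hexpand : f v = v + cos v * (sin v - v * cos v) := by
      rw [hf]
      linear_combination v * sin_sq_add_cos_sq v
    have hfactor : sin v - v * cos v ≤ 1 := by
      linarith [sin_le_one v, mul_nonneg h0 hcos.le]
    linarith [mul_le_of_le_one_right hcos.le hfactor]
  · have hmem : Ioo 0 (π / 2) ∈ nhdsWithin (π / 2) (Iio (π / 2)) :=
      Ioo_mem_nhdsLT (by linarith)
    obtain ⟨v, hv, hfv⟩ := (Filter.Eventually.and hmem (hlim.eventually_const_lt hone)).exists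
    exact ⟨v, hv, hfv⟩
end

section
/- Let H > 0, τ ∈ ℝ and v > 0, and set t_s = τ − (1/(2H)) ln(1 + v²). Then the improper integral ∫_{t_s}^{τ} e^{H(τ−t)} (e^{2Hτ} − e^{2Ht})^{−1/2} dt converges and equals v e^{−Hτ}/H. Equivalently, in the de Sitter universe the comoving particle at coordinate χ = v e^{−Hτ}/H meets the Fermi space slice of the central observer at proper time τ at coordinate time t_s(τ, χ) = τ − (1/(2H)) ln(1 + v²), where v = H χ e^{Hτ}. -/
open Real Set MeasureTheory

/-- An antiderivative of the de Sitter Fermi slice integrand, for times before `τ`. -/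
lemma hasDerivAt_deSitter_slice {H τ t : ℝ} (hH : 0 < H) (ht : t < τ) :
    HasDerivAt (fun t => -(exp (-H * τ) / H) * √(exp (2 * H * (τ - t)) - 1))
      (exp (H * (τ - t)) / √(exp (2 * H * τ) - exp (2 * H * t))) t := by
  have hE : 0 < exp (2 * H * (τ - t)) - 1 := by
    have : 0 < 2 * H * (τ - t) := by have := sub_pos.2 ht; positivity
    linarith [one_lt_exp_iff.2 this]
  have hsqrt : √(exp (2 * H * τ) - exp (2 * H * t)) =
      exp (H * t) * √(exp (2 * H * (τ - t)) - 1) := by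
    have hfac : exp (2 * H * τ) - exp (2 * H * t) =
        exp (H * t) ^ 2 * (exp (2 * H * (τ - t)) - 1) := by
      rw [mul_sub, ← exp_nat_mul, ← exp_add]
      push_cast
      ring_nf
    rw [hfac, sqrt_mul (sq_nonneg _), sqrt_sq (exp_pos _).le]
  have hlin : HasDerivAt (fun t => 2 * H * (τ - t)) (2 * H * -1) t :=
    ((hasDerivAt_id t).const_sub τ).const_mul (2 * H)
  refine (((hlin.exp.sub_const 1).sqrt hE.ne').const_mul (-(exp (-H * τ) / H))).congr_deriv ?_
  have hexp : exp (H * (τ - t)) = exp (-H * τ) * exp (2 * H * (τ - t)) * exp (H * t) := by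
    rw [← exp_add, ← exp_add]
    ring_nf
  rw [hsqrt, hexp]
  field_simp

/-- In the de Sitter universe (`a(t) = e^{Ht}`, `H > 0`), with
`t_s = τ − (1/(2H)) ln(1 + v²)` for `v > 0`,
`∫_{t_s}^{τ} e^{H(τ−t)} (e^{2Hτ} − e^{2Ht})^{−1/2} dt = v e^{−Hτ}/H`; i.e. the comoving
particle at coordinate `χ = v e^{−Hτ}/H` meets the Fermi space slice at time `t_s`. -/
theorem deSitter_fermi_slice_time
    (H τ v ts : ℝ) (hH : 0 < H) (hv : 0 < v)
    (hts : ts = τ - (1/(2*H)) * Real.log (1 + v^2)) :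
    IntegrableOn
      (fun t => Real.exp (H*(τ-t)) / Real.sqrt (Real.exp (2*H*τ) - Real.exp (2*H*t)))
      (Ioo ts τ) ∧
    (∫ t in Ioo ts τ,
        Real.exp (H*(τ-t)) / Real.sqrt (Real.exp (2*H*τ) - Real.exp (2*H*t))) =
      v * Real.exp (-H*τ) / H := by
  have hlog : 0 < Real.log (1 + v ^ 2) := Real.log_pos (by nlinarith)
  have hle : ts ≤ τ := by
    have : 0 < (1 / (2 * H)) * Real.log (1 + v ^ 2) := by positivity
    linarith
  have hcont : ContinuousOn
      (fun t => -(exp (-H * τ) / H) * √(exp (2 * H * (τ - t)) - 1)) (Icc ts τ) := by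
    fun_prop
  have hderiv := fun t (ht : t ∈ Ioo ts τ) => hasDerivAt_deSitter_slice hH ht.2
  have hint := intervalIntegral.integrableOn_deriv_of_nonneg hcont hderiv
    fun t _ => by positivity
  refine ⟨hint.mono_set Ioo_subset_Ioc_self, ?_⟩
  have hts_exp : exp (2 * H * (τ - ts)) = 1 + v ^ 2 := by
    have : 2 * H * (τ - ts) = Real.log (1 + v ^ 2) := by
      rw [hts]
      field_simp
      ring
    rw [this, exp_log (by positivity)]
  rw [← integral_Ioc_eq_integral_Ioo, ← intervalIntegral.integral_of_le hle,
    intervalIntegral.integral_eq_sub_of_hasDerivAt_of_le hle hcont hderiv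
      ((intervalIntegrable_iff_integrableOn_Ioc_of_le hle).2 hint), hts_exp]
  simp only [sub_self, mul_zero, exp_zero, sqrt_zero, add_sub_cancel_left, sqrt_sq hv.le]
  ring
end

section
/- Let H > 0 and t_s < τ be real numbers. Then the improper integral ∫_{t_s}^{τ} e^{Ht} (e^{2Hτ} − e^{2Ht})^{−1/2} dt converges and equals (1/H) arccos(e^{−H(τ − t_s)}). In particular, for t_s = τ − (1/(2H)) ln(1 + v²) with v > 0, the Fermi distance in the de Sitter universe is ρ = (1/H) arccos(1/√(1 + v²)). -/
open Real Set MeasureTheory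

/-- On `t < τ`, the de Sitter integrand has the antiderivative `-(1/H) arccos(e^{H(t-τ)})`. -/
theorem hasDerivAt_neg_arccos_exp {H τ t : ℝ} (hH : 0 < H) (ht : t < τ) :
    HasDerivAt (fun t => -((1/H) * Real.arccos (Real.exp (H*(t - τ)))))
      (Real.exp (H*t) / Real.sqrt (Real.exp (2*H*τ) - Real.exp (2*H*t))) t := by
  have hlt : Real.exp (H*(t - τ)) < 1 :=
    Real.exp_lt_one_iff.2 (mul_neg_of_pos_of_neg hH (sub_neg.2 ht))
  have hpos := Real.exp_pos (H*(t - τ))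
  have hexp : HasDerivAt (fun t => Real.exp (H*(t - τ))) (Real.exp (H*(t - τ)) * H) t := by
    simpa using (((hasDerivAt_id t).sub_const τ).const_mul H).exp
  have hder := (((Real.hasDerivAt_arccos (by linarith) hlt.ne).comp t hexp).const_mul (1/H)).neg
  refine hder.congr_deriv ?_
  have hnum : Real.exp (H*t) = Real.exp (H*τ) * Real.exp (H*(t - τ)) := by
    rw [← Real.exp_add]; ring_nf
  have hden : Real.exp (2*H*τ) - Real.exp (2*H*t) =
      Real.exp (H*τ) ^ 2 * (1 - Real.exp (H*(t - τ)) ^ 2) := by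
    rw [mul_sub, mul_one, ← mul_pow, ← hnum, ← Real.exp_nat_mul, ← Real.exp_nat_mul]
    push_cast
    ring_nf
  have hsqrt : 0 < Real.sqrt (1 - Real.exp (H*(t - τ)) ^ 2) :=
    Real.sqrt_pos.2 (by nlinarith)
  rw [hden, Real.sqrt_mul (sq_nonneg _), Real.sqrt_sq (Real.exp_pos _).le, hnum]
  have hτ := Real.exp_pos (H*τ)
  field_simp

/-- For `H > 0` and `t_s < τ`,
`∫_{t_s}^{τ} e^{Ht} (e^{2Hτ} − e^{2Ht})^{−1/2} dt = (1/H) arccos(e^{−H(τ−t_s)})`.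
In particular, for `t_s = τ − (1/(2H)) ln(1+v²)` with `v > 0`, the Fermi distance in the
de Sitter universe is `ρ = (1/H) arccos(1/√(1+v²))`. -/
theorem deSitter_fermi_distance
    (H ts τ : ℝ) (hH : 0 < H) (h : ts < τ) :
    IntegrableOn
      (fun t => Real.exp (H*t) / Real.sqrt (Real.exp (2*H*τ) - Real.exp (2*H*t)))
      (Ioo ts τ) ∧
    (∫ t in Ioo ts τ,
        Real.exp (H*t) / Real.sqrt (Real.exp (2*H*τ) - Real.exp (2*H*t))) =
      (1/H) * Real.arccos (Real.exp (-H*(τ - ts))) ∧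
    (∀ v : ℝ, 0 < v → ts = τ - (1/(2*H)) * Real.log (1 + v^2) →
      (∫ t in Ioo ts τ,
          Real.exp (H*t) / Real.sqrt (Real.exp (2*H*τ) - Real.exp (2*H*t))) =
        (1/H) * Real.arccos (1 / Real.sqrt (1 + v^2))) := by
  have hcont : ContinuousOn (fun t => -((1/H) * Real.arccos (Real.exp (H*(t - τ)))))
      (Icc ts τ) :=
    (continuous_const.mul (Real.continuous_arccos.comp (by fun_prop))).neg.continuousOn
  have hint : IntegrableOn
      (fun t => Real.exp (H*t) / Real.sqrt (Real.exp (2*H*τ) - Real.exp (2*H*t)))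
      (Ioc ts τ) :=
    intervalIntegral.integrableOn_deriv_of_nonneg hcont
      (fun t ht => hasDerivAt_neg_arccos_exp hH ht.2) (fun t _ => by positivity)
  have hval : (∫ t in Ioo ts τ,
      Real.exp (H*t) / Real.sqrt (Real.exp (2*H*τ) - Real.exp (2*H*t))) =
      (1/H) * Real.arccos (Real.exp (-H*(τ - ts))) := by
    rw [← integral_Ioc_eq_integral_Ioo, ← intervalIntegral.integral_of_le h.le,
      intervalIntegral.integral_eq_sub_of_hasDerivAt_of_le h.le hcont
        (fun t ht => hasDerivAt_neg_arccos_exp hH ht.2)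
        ((intervalIntegrable_iff_integrableOn_Ioc_of_le h.le).2 hint),
      show -H*(τ - ts) = H*(ts - τ) by ring]
    simp
  refine ⟨hint.mono_set Ioo_subset_Ioc_self, hval, fun v _ hts => ?_⟩
  have hv : 0 < 1 + v^2 := by positivity
  have hexponent : -H*(τ - ts) = -(Real.log (1 + v^2) / 2) := by
    rw [hts]
    field_simp
    ring
  rw [hval, hexponent, Real.exp_neg, ← Real.log_sqrt hv.le,
    Real.exp_log (Real.sqrt_pos.2 hv), one_div (Real.sqrt _)]
end

section
/- Let H > 0 and χ > 0. For τ ∈ ℝ write v(τ) = H χ e^{Hτ} and set t_ℓ(τ) = τ − (1/H) ln(1 + v(τ)). Then: (i) ∫_{t_ℓ(τ)}^{τ} e^{−Ht} dt = χ; (ii) the affine distance δ(τ) = e^{−Hτ} ∫_{t_ℓ(τ)}^{τ} e^{Ht} dt equals (1/H) · v(τ)/(1 + v(τ)); (iii) δ is differentiable with δ'(τ) = v(τ)/(1 + v(τ))² = H δ(τ)(1 − H δ(τ)). -/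
open Real Set MeasureTheory intervalIntegral

/-- The primitive of `t ↦ exp (c * t)` evaluated between two points. -/
theorem integral_exp_const_mul {c : ℝ} (hc : c ≠ 0) (a b : ℝ) :
    ∫ t in a..b, Real.exp (c * t) = (Real.exp (c * b) - Real.exp (c * a)) / c := by
  rw [intervalIntegral.integral_comp_mul_left (fun x => Real.exp x) hc, integral_exp, smul_eq_mul]
  ring

/-- The exponential at a time delayed by `(1 / H) * log w`. -/
theorem exp_mul_sub_log {H w : ℝ} (hH : H ≠ 0) (hw : 0 < w) (τ : ℝ) :
    Real.exp (H * (τ - (1 / H) * Real.log w)) = Real.exp (H * τ) / w := by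
  have h : H * (τ - (1 / H) * Real.log w) = H * τ - Real.log w := by field_simp
  rw [h, Real.exp_sub, Real.exp_log hw]

/-- In the de Sitter universe (`a(t) = e^{Ht}`, `H > 0`), with
`v(τ) = Hχe^{Hτ}` and `t_ℓ(τ) = τ − (1/H) ln(1 + v(τ))`:
(i) `∫_{t_ℓ(τ)}^{τ} e^{−Ht} dt = χ`;
(ii) the affine distance `δ(τ) = e^{−Hτ} ∫_{t_ℓ(τ)}^{τ} e^{Ht} dt = (1/H) v(τ)/(1+v(τ))`;
(iii) `δ'(τ) = v(τ)/(1+v(τ))² = Hδ(τ)(1 − Hδ(τ))`. -/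
theorem deSitter_astrometric
    (H χ : ℝ) (hH : 0 < H) (hχ : 0 < χ)
    (v tl δ : ℝ → ℝ)
    (hv : ∀ τ, v τ = H * χ * Real.exp (H*τ))
    (htl : ∀ τ, tl τ = τ - (1/H) * Real.log (1 + v τ))
    (hδ : ∀ τ, δ τ = Real.exp (-H*τ) * ∫ t in tl τ..τ, Real.exp (H*t)) :
    (∀ τ : ℝ, (∫ t in tl τ..τ, Real.exp (-H*t)) = χ) ∧
    (∀ τ : ℝ, δ τ = (1/H) * (v τ / (1 + v τ))) ∧
    (∀ τ : ℝ, HasDerivAt δ (v τ / (1 + v τ)^2) τ ∧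
      v τ / (1 + v τ)^2 = H * δ τ * (1 - H * δ τ)) := by
  have hv0 : ∀ τ, 0 < v τ := fun τ => by rw [hv]; positivity
  have hw0 : ∀ τ, 0 < 1 + v τ := fun τ => by linarith [hv0 τ]
  have hexp : ∀ τ, Real.exp (H * tl τ) = Real.exp (H * τ) / (1 + v τ) := fun τ => by
    rw [htl, exp_mul_sub_log hH.ne' (hw0 τ)]
  have hδv : ∀ τ, δ τ = (1 / H) * (v τ / (1 + v τ)) := fun τ => by
    have hw := (hw0 τ).ne'
    have he := (Real.exp_pos (H * τ)).ne'
    rw [hδ, integral_exp_const_mul hH.ne', hexp, neg_mul, Real.exp_neg]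
    field_simp
    ring
  refine ⟨fun τ => ?_, hδv, fun τ => ⟨?_, ?_⟩⟩
  · have hw := (hw0 τ).ne'
    have he := (Real.exp_pos (H * τ)).ne'
    rw [integral_exp_const_mul (neg_ne_zero.mpr hH.ne'), neg_mul, neg_mul, Real.exp_neg,
      Real.exp_neg, hexp, inv_div, hv]
    field_simp
    ring
  · have hw := (hw0 τ).ne'
    have hdv : HasDerivAt v (H * v τ) τ := by
      rw [funext hv]
      refine ((((hasDerivAt_id τ).const_mul H).exp).const_mul (H * χ)).congr_deriv ?_
      simp only [id_eq]
      ring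
    rw [funext hδv]
    refine ((hdv.div (hdv.const_add 1) hw).const_mul (1 / H)).congr_deriv ?_
    field_simp
    ring
  · have hw := (hw0 τ).ne'
    rw [hδv]
    field_simp
    ring
end

section
/- Let H > 0, χ > 0, τ ∈ ℝ, and set v = H χ e^{Hτ} and τ* = τ − (1/(2H)) ln(1 + 2v). Then v* := H χ e^{Hτ*} satisfies v* = v/√(1 + 2v), and τ* − (1/(2H)) ln(1 + v*²) = τ − (1/H) ln(1 + v). That is, in the de Sitter universe the spacelike-simultaneous event of the comoving particle at observer time τ* coincides with the lightlike-simultaneous (emission) event at observer time τ. -/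
open Real

/-- Retarded comparison in the de Sitter universe: with `v = Hχe^{Hτ}` and
`τ* = τ − (1/(2H)) ln(1 + 2v)`, the Hubble speed `v* = Hχe^{Hτ*}` satisfies
`v* = v/√(1+2v)`, and `t_s(τ*,χ) = τ* − (1/(2H)) ln(1+v*²)` coincides with
`t_ℓ(τ,χ) = τ − (1/H) ln(1+v)`. -/
theorem deSitter_retarded_comparison
    (H χ τ v τs vs : ℝ) (hH : 0 < H) (hχ : 0 < χ)
    (hv : v = H * χ * Real.exp (H*τ))
    (hτs : τs = τ - (1/(2*H)) * Real.log (1 + 2*v))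
    (hvs : vs = H * χ * Real.exp (H*τs)) :
    vs = v / Real.sqrt (1 + 2*v) ∧
    τs - (1/(2*H)) * Real.log (1 + vs^2) = τ - (1/H) * Real.log (1 + v) := by
  have hv0 : 0 < v := hv ▸ by positivity
  have h1 : 0 < 1 + 2 * v := by positivity
  have hexp : H * τs = H * τ - Real.log (Real.sqrt (1 + 2 * v)) := by
    rw [Real.log_sqrt h1.le, hτs]
    field_simp
  have hvs' : vs = v / Real.sqrt (1 + 2 * v) := by
    rw [hvs, hexp, Real.exp_sub, Real.exp_log (Real.sqrt_pos.mpr h1), ← mul_div_assoc, ← hv]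
  refine ⟨hvs', ?_⟩
  have hsq : 1 + vs ^ 2 = (1 + v) ^ 2 / (1 + 2 * v) := by
    rw [hvs', div_pow, Real.sq_sqrt h1.le]
    field_simp
    ring
  rw [hsq, Real.log_div (by positivity) h1.ne', Real.log_pow, hτs]
  push_cast
  field_simp
  ring
end

section
/- Let τ > 0 and v ∈ (0, π/2). Then the improper integral ∫_{τ cos²v}^{τ} √τ / (√t · √(τ − t)) dt converges and equals 2√τ · v. In particular, in the radiation-dominated universe (scale factor a(t) = √t), the comoving particle at coordinate χ = 2√τ · v meets the Fermi space slice of the central observer at proper time τ at coordinate time t_s = τ cos²v. -/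
open Real Set MeasureTheory

theorem hasDerivAt_mul_cos_sq (τ u : ℝ) :
    HasDerivAt (fun u => τ * Real.cos u ^ 2) (-(2 * τ * (Real.cos u * Real.sin u))) u := by
  refine (((Real.hasDerivAt_cos u).fun_pow 2).const_mul τ).congr_deriv ?_
  norm_num
  ring

theorem strictAntiOn_mul_cos_sq {τ : ℝ} (hτ : 0 < τ) :
    StrictAntiOn (fun u => τ * Real.cos u ^ 2) (Icc 0 (π / 2)) := by
  intro x hx y hy hxy
  have hcos : Real.cos y < Real.cos x :=
    Real.cos_lt_cos_of_nonneg_of_le_pi_div_two hx.1 hy.2 hxy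
  have hy0 : 0 ≤ Real.cos y :=
    Real.cos_nonneg_of_mem_Icc ⟨by linarith [hy.1, Real.pi_pos], hy.2⟩
  exact mul_lt_mul_of_pos_left (pow_lt_pow_left₀ hcos hy0 two_ne_zero) hτ

theorem image_mul_cos_sq_Ioo {τ v : ℝ} (hτ : 0 < τ) (hv : v ∈ Ioo 0 (π / 2)) :
    (fun u => τ * Real.cos u ^ 2) '' Ioo 0 v = Ioo (τ * Real.cos v ^ 2) τ := by
  apply Subset.antisymm
  · rintro _ ⟨u, hu, rfl⟩
    have hu' : u ∈ Icc 0 (π / 2) := ⟨hu.1.le, (hu.2.trans hv.2).le⟩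
    refine ⟨strictAntiOn_mul_cos_sq hτ hu' ⟨hv.1.le, hv.2.le⟩ hu.2, ?_⟩
    simpa using strictAntiOn_mul_cos_sq hτ ⟨le_rfl, by positivity⟩ hu' hu.1
  · have hcont : ContinuousOn (fun u => τ * Real.cos u ^ 2) (Icc 0 v) := by fun_prop
    simpa using intermediate_value_Ioo' hv.1.le hcont

theorem abs_deriv_smul_integrand {τ u : ℝ} (hτ : 0 < τ) (hu : u ∈ Ioo 0 (π / 2)) :
    |-(2 * τ * (Real.cos u * Real.sin u))| •
      (Real.sqrt τ / (Real.sqrt (τ * Real.cos u ^ 2) * Real.sqrt (τ - τ * Real.cos u ^ 2))) =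
      2 * Real.sqrt τ := by
  have hc : 0 < Real.cos u :=
    Real.cos_pos_of_mem_Ioo ⟨by linarith [hu.1, Real.pi_pos], hu.2⟩
  have hs : 0 < Real.sin u :=
    Real.sin_pos_of_pos_of_lt_pi hu.1 (by linarith [hu.2, Real.pi_pos])
  have hsub : τ - τ * Real.cos u ^ 2 = τ * Real.sin u ^ 2 := by
    rw [Real.sin_sq]
    ring
  have hprod : Real.sqrt (τ * Real.cos u ^ 2) * Real.sqrt (τ * Real.sin u ^ 2) =
      τ * (Real.cos u * Real.sin u) := by
    rw [Real.sqrt_mul hτ.le, Real.sqrt_mul hτ.le, Real.sqrt_sq hc.le, Real.sqrt_sq hs.le,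
      mul_mul_mul_comm, Real.mul_self_sqrt hτ.le]
  rw [hsub, hprod, abs_neg, abs_of_pos (by positivity), smul_eq_mul]
  field_simp

/-- In the radiation-dominated universe (`a(t) = √t`), for `τ > 0` and
`v ∈ (0, π/2)`, `∫_{τ cos²v}^{τ} √τ/(√t √(τ − t)) dt = 2√τ · v`; i.e. the comoving
particle at coordinate `χ = 2√τ · v` meets the Fermi space slice at `t_s = τ cos²v`. -/
theorem radiation_fermi_slice_time
    (τ v : ℝ) (hτ : 0 < τ) (hv : v ∈ Ioo 0 (π/2)) :
    IntegrableOn (fun t => Real.sqrt τ / (Real.sqrt t * Real.sqrt (τ - t)))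
      (Ioo (τ * Real.cos v ^ 2) τ) ∧
    (∫ t in Ioo (τ * Real.cos v ^ 2) τ,
        Real.sqrt τ / (Real.sqrt t * Real.sqrt (τ - t))) = 2 * Real.sqrt τ * v := by
  have him := image_mul_cos_sq_Ioo hτ hv
  have hderiv : ∀ u ∈ Ioo 0 v, HasDerivWithinAt (fun u => τ * Real.cos u ^ 2)
      (-(2 * τ * (Real.cos u * Real.sin u))) (Ioo 0 v) u := fun u _ =>
    (hasDerivAt_mul_cos_sq τ u).hasDerivWithinAt
  have hinj : InjOn (fun u => τ * Real.cos u ^ 2) (Ioo 0 v) :=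
    (strictAntiOn_mul_cos_sq hτ).injOn.mono
      (Ioo_subset_Icc_self.trans (Icc_subset_Icc_right hv.2.le))
  have hconst : EqOn (fun u => |-(2 * τ * (Real.cos u * Real.sin u))| •
      (Real.sqrt τ / (Real.sqrt (τ * Real.cos u ^ 2) * Real.sqrt (τ - τ * Real.cos u ^ 2))))
      (fun _ => 2 * Real.sqrt τ) (Ioo 0 v) := fun u hu =>
    abs_deriv_smul_integrand hτ ⟨hu.1, hu.2.trans hv.2⟩
  rw [← him]
  constructor
  · rw [integrableOn_image_iff_integrableOn_abs_deriv_smul measurableSet_Ioo hderiv hinj,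
      integrableOn_congr_fun hconst measurableSet_Ioo]
    exact integrableOn_const (by simp)
  · rw [integral_image_eq_integral_abs_deriv_smul measurableSet_Ioo hderiv hinj,
      setIntegral_congr_fun measurableSet_Ioo hconst]
    simp [hv.1.le, mul_comm]
end

section
/- Let τ > 0 and v ∈ (0, π/2). Then the improper integral ∫_{τ cos²v}^{τ} √t / √(τ − t) dt converges and equals (v + sin v cos v) τ. In particular, in the radiation-dominated universe the Fermi distance from the central observer at proper time τ to the comoving particle with Hubble speed v is ρ = (v + cos v sin v) τ. -/
open Real Set MeasureTheory

theorem hasDerivAt_sqrt_div_sqrt_sub_primitive {τ t : ℝ} (ht : 0 < t) (htτ : t < τ) :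
    HasDerivAt (fun t => -(τ * Real.arccos (Real.sqrt t / Real.sqrt τ) +
      Real.sqrt t * Real.sqrt (τ - t))) (Real.sqrt t / Real.sqrt (τ - t)) t := by
  have hτ : 0 < τ := ht.trans htτ
  have hd : 0 < τ - t := sub_pos.2 htτ
  have ha := Real.sqrt_pos.2 ht
  have hb := Real.sqrt_pos.2 hd
  have hc := Real.sqrt_pos.2 hτ
  have ha2 := Real.sq_sqrt ht.le
  have hb2 := Real.sq_sqrt hd.le
  have hc2 := Real.sq_sqrt hτ.le
  have hlt : √t / √τ < 1 := (div_lt_one hc).2 (Real.sqrt_lt_sqrt ht.le htτ)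
  have hpos : 0 < √t / √τ := div_pos ha hc
  have hs : √(1 - (√t / √τ) ^ 2) = √(τ - t) / √τ := by
    rw [← Real.sqrt_div hd.le, div_pow, ha2, hc2, sub_div, div_self hτ.ne']
  have h1 := (Real.hasDerivAt_arccos (by linarith) hlt.ne).comp t
    ((Real.hasDerivAt_sqrt ht.ne').div_const (√τ))
  have h2 := (Real.hasDerivAt_sqrt ht.ne').mul (((hasDerivAt_id t).const_sub τ).sqrt hd.ne')
  refine ((h1.const_mul τ).add h2).neg.congr_deriv ?_
  rw [hs]
  simp only [id]
  field_simp
  rw [ha2, hb2]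
  ring

/-- In the radiation-dominated universe (`a(t) = √t`), for `τ > 0` and
`v ∈ (0, π/2)`, the Fermi distance to the comoving particle with Hubble speed `v` is
`∫_{τ cos²v}^{τ} √t/√(τ − t) dt = (v + sin v cos v) τ`. -/
theorem radiation_fermi_distance
    (τ v : ℝ) (hτ : 0 < τ) (hv : v ∈ Ioo 0 (π/2)) :
    IntegrableOn (fun t => Real.sqrt t / Real.sqrt (τ - t))
      (Ioo (τ * Real.cos v ^ 2) τ) ∧
    (∫ t in Ioo (τ * Real.cos v ^ 2) τ, Real.sqrt t / Real.sqrt (τ - t)) =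
      (v + Real.sin v * Real.cos v) * τ := by
  have hcos : 0 < Real.cos v := Real.cos_pos_of_mem_Ioo ⟨by linarith [hv.1, hv.2], hv.2⟩
  have hsin : 0 < Real.sin v := Real.sin_pos_of_pos_of_lt_pi hv.1 (by linarith [hv.1, hv.2])
  have h0 : 0 < τ * Real.cos v ^ 2 := by positivity
  have hle : τ * Real.cos v ^ 2 ≤ τ := by nlinarith [Real.cos_sq_le_one v]
  have hcont : ContinuousOn (fun t => -(τ * Real.arccos (√t / √τ) + √t * √(τ - t)))
      (Icc (τ * Real.cos v ^ 2) τ) := by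
    have := Real.continuous_arccos
    fun_prop
  have hderiv : ∀ t ∈ Ioo (τ * Real.cos v ^ 2) τ, HasDerivAt
      (fun t => -(τ * Real.arccos (√t / √τ) + √t * √(τ - t))) (√t / √(τ - t)) t :=
    fun t ht => hasDerivAt_sqrt_div_sqrt_sub_primitive (h0.trans ht.1) ht.2
  have hint := intervalIntegral.integrableOn_deriv_of_nonneg hcont hderiv
    (fun t _ => by positivity)
  refine ⟨hint.mono_set Ioo_subset_Ioc_self, ?_⟩
  rw [← integral_Ioc_eq_integral_Ioo, ← intervalIntegral.integral_of_le hle,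
    intervalIntegral.integral_eq_sub_of_hasDerivAt_of_le hle hcont hderiv
      ((intervalIntegrable_iff_integrableOn_Ioc_of_le hle).2 hint)]
  have hc := Real.sqrt_pos.2 hτ
  have hsq : √(τ * Real.cos v ^ 2) = √τ * Real.cos v := by
    rw [Real.sqrt_mul hτ.le, Real.sqrt_sq hcos.le]
  have hsq' : √(τ - τ * Real.cos v ^ 2) = √τ * Real.sin v := by
    rw [show τ - τ * Real.cos v ^ 2 = τ * Real.sin v ^ 2 by rw [Real.sin_sq]; ring,
      Real.sqrt_mul hτ.le, Real.sqrt_sq hsin.le]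
  rw [hsq, hsq', mul_div_cancel_left₀ _ hc.ne', div_self hc.ne', sub_self,
    Real.arccos_cos hv.1.le (by linarith [hv.1, hv.2]), Real.arccos_one, Real.sqrt_zero]
  linear_combination Real.cos v * Real.sin v * Real.sq_sqrt hτ.le
end
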